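/- arXiv:2602.06102 — 2 statements merged into one kernel-verified Lean document; each statement's English description precedes it below -/
import Mathlib

section
/- Real Kharitonov theorem (K4PT): Let N ≥ 1 and let l, u : {0,…,N} → ℝ satisfy l n ≤ u n for all n and 0 < l N. Then every member polynomial P_a(s) = Σ_{n=0}^N a_n s^n with l n ≤ a_n ≤ u n for all n is Hurwitz (as a polynomial over ℂ) if and only if the four real Kharitonov polynomials K₁, K₂, K₃, K₄ of the family are Hurwitz. -/
open Polynomial

/-- The member polynomial `∑ a_n s^n` of a real interval family, viewed in `ℂ[s]`. -/
noncomputable def rmember (N : ℕ) (a : ℕ → ℝ) : Polynomial ℂ :=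
  ∑ n ∈ Finset.range (N + 1), C ((a n : ℂ)) * X ^ n

/-- Pattern selection according to `n % 4`: `true` means take the upper endpoint. -/
def pat (w x y z : Bool) (n : ℕ) : Bool :=
  match n % 4 with
  | 0 => w
  | 1 => x
  | 2 => y
  | _ => z

/-- Pick the lower or upper endpoint according to the pattern. -/
def pick (l u : ℕ → ℝ) (p : ℕ → Bool) (n : ℕ) : ℝ := if p n then u n else l n

/-- A polynomial is Hurwitz if it is nonzero and has no roots with nonnegative real part. -/
def Hurwitz (P : Polynomial ℂ) : Prop :=
  P ≠ 0 ∧ ∀ z : ℂ, 0 ≤ z.re → P.eval z ≠ 0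

/-! ### Evaluation and degree of member polynomials -/

theorem eval_rmember (N : ℕ) (a : ℕ → ℝ) (z : ℂ) :
    (rmember N a).eval z = ∑ n ∈ Finset.range (N + 1), (a n : ℂ) * z ^ n := by
  simp [rmember, eval_finsetSum]

theorem eval_derivative_rmember (N : ℕ) (a : ℕ → ℝ) (z : ℂ) :
    (derivative (rmember N a)).eval z =
      ∑ n ∈ Finset.range (N + 1), ((a n * n : ℝ) : ℂ) * z ^ (n - 1) := by
  simp [rmember, eval_finsetSum, derivative_X_pow, mul_assoc]

theorem coeff_rmember (N : ℕ) (a : ℕ → ℝ) (k : ℕ) :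
    (rmember N a).coeff k = if k ≤ N then (a k : ℂ) else 0 := by
  simp [rmember, coeff_C_mul, coeff_X_pow]

theorem natDegree_rmember {N : ℕ} {a : ℕ → ℝ} (ha : a N ≠ 0) :
    (rmember N a).natDegree = N := by
  refine natDegree_eq_of_le_of_coeff_ne_zero ?_ (by simpa [coeff_rmember] using ha)
  refine natDegree_le_iff_coeff_eq_zero.2 fun k hk => ?_
  simp [coeff_rmember, not_le.2 hk]

theorem leadingCoeff_rmember {N : ℕ} {a : ℕ → ℝ} (ha : a N ≠ 0) :
    (rmember N a).leadingCoeff = a N := by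
  rw [leadingCoeff, natDegree_rmember ha, coeff_rmember, if_pos le_rfl]

theorem rmember_ne_zero {N : ℕ} {a : ℕ → ℝ} (ha : a N ≠ 0) : rmember N a ≠ 0 := by
  rw [← leadingCoeff_ne_zero, leadingCoeff_rmember ha]
  exact_mod_cast ha

theorem eval_rmember_conj (N : ℕ) (a : ℕ → ℝ) (z : ℂ) :
    (rmember N a).eval ((starRingEnd ℂ) z) = (starRingEnd ℂ) ((rmember N a).eval z) := by
  simp [eval_rmember]

/-! ### Root estimates for Hurwitz polynomials -/

theorem pow_card_le_multiset_prod {c : ℝ} (hc : 0 ≤ c) (g : ℂ → ℝ) (s : Multiset ℂ)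
    (h : ∀ r ∈ s, c ≤ g r) : c ^ Multiset.card s ≤ (s.map g).prod := by
  induction s using Multiset.induction_on with
  | empty => simp
  | cons r s ih =>
    have hs := ih fun x hx => h x (Multiset.mem_cons_of_mem hx)
    have hr := h r (Multiset.mem_cons_self r s)
    rw [Multiset.card_cons, pow_succ', Multiset.map_cons, Multiset.prod_cons]
    exact mul_le_mul hr hs (by positivity) (hc.trans hr)

theorem norm_eval_eq_prod_roots (P : ℂ[X]) (z : ℂ) :
    ‖P.eval z‖ = ‖P.leadingCoeff‖ * (P.roots.map fun r => ‖z - r‖).prod := by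
  rw [(IsAlgClosed.splits P).eval_eq_prod_roots, norm_mul]
  congr 1
  induction P.roots using Multiset.induction_on with
  | empty => simp
  | cons r s ih => simp [ih]

theorem Hurwitz.re_root_neg {P : ℂ[X]} (hP : Hurwitz P) {r : ℂ} (hr : r ∈ P.roots) : r.re < 0 := by
  by_contra! h
  exact hP.2 r h (isRoot_of_mem_roots hr)

theorem Hurwitz.leadingCoeff_mul_re_pow_le {P : ℂ[X]} (hP : Hurwitz P) {z : ℂ} (hz : 0 ≤ z.re) :
    ‖P.leadingCoeff‖ * z.re ^ P.natDegree ≤ ‖P.eval z‖ := by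
  rw [norm_eval_eq_prod_roots, ← IsAlgClosed.card_roots_eq_natDegree]
  gcongr
  refine pow_card_le_multiset_prod hz _ _ fun r hr => ?_
  have h1 := hP.re_root_neg hr
  have h2 := Complex.re_le_norm (z - r)
  rw [Complex.sub_re] at h2
  linarith

theorem exists_pow_card_le_prod_norm_sub (s : Multiset ℂ) (hs : ∀ r ∈ s, r.re < 0) :
    ∃ δ > 0, ∀ z : ℂ, 0 ≤ z.re →
      δ * (1 + ‖z‖) ^ Multiset.card s ≤ (s.map fun r => ‖z - r‖).prod := by
  induction s using Multiset.induction_on with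
  | empty => exact ⟨1, one_pos, by simp⟩
  | cons r s ih =>
    obtain ⟨δ, hδ, h⟩ := ih fun x hx => hs x (Multiset.mem_cons_of_mem hx)
    have hr := hs r (Multiset.mem_cons_self r s)
    have hden : 0 < 1 + ‖r‖ - r.re := by linarith [norm_nonneg r]
    refine ⟨-r.re / (1 + ‖r‖ - r.re) * δ, mul_pos (div_pos (by linarith) hden) hδ, fun z hz => ?_⟩
    have h1 : -r.re ≤ ‖z - r‖ := by
      have := Complex.re_le_norm (z - r)
      rw [Complex.sub_re] at this
      linarith
    have h2 : ‖z‖ ≤ ‖z - r‖ + ‖r‖ := by simpa using norm_add_le (z - r) r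
    have h3 : -r.re / (1 + ‖r‖ - r.re) * (1 + ‖z‖) ≤ ‖z - r‖ := by
      rw [div_mul_eq_mul_div, div_le_iff₀ hden]
      nlinarith [norm_nonneg r]
    rw [Multiset.card_cons, Multiset.map_cons, Multiset.prod_cons]
    calc -r.re / (1 + ‖r‖ - r.re) * δ * (1 + ‖z‖) ^ (Multiset.card s + 1)
        = (-r.re / (1 + ‖r‖ - r.re) * (1 + ‖z‖)) * (δ * (1 + ‖z‖) ^ Multiset.card s) := by ring
      _ ≤ _ := mul_le_mul h3 (h z hz) (by positivity) (norm_nonneg _)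

theorem Hurwitz.exists_mul_pow_le {P : ℂ[X]} (hP : Hurwitz P) :
    ∃ δ > 0, ∀ z : ℂ, 0 ≤ z.re → δ * (1 + ‖z‖) ^ P.natDegree ≤ ‖P.eval z‖ := by
  obtain ⟨δ, hδ, h⟩ := exists_pow_card_le_prod_norm_sub P.roots fun r hr => hP.re_root_neg hr
  have hlc : 0 < ‖P.leadingCoeff‖ := norm_pos_iff.2 (leadingCoeff_ne_zero.2 hP.1)
  refine ⟨‖P.leadingCoeff‖ * δ, mul_pos hlc hδ, fun z hz => ?_⟩
  rw [norm_eval_eq_prod_roots, ← IsAlgClosed.card_roots_eq_natDegree, mul_assoc]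
  gcongr
  exact h z hz

theorem exists_norm_eval_rmember_le (N : ℕ) (a : ℕ → ℝ) :
    ∃ M > 0, ∀ z : ℂ, ‖(rmember N a).eval z‖ ≤ M * (1 + ‖z‖) ^ N := by
  refine ⟨∑ n ∈ Finset.range (N + 1), |a n| + 1, by positivity, fun z => ?_⟩
  have hz := norm_nonneg z
  have : ‖(rmember N a).eval z‖ ≤ ∑ n ∈ Finset.range (N + 1), |a n| * (1 + ‖z‖) ^ N := by
    rw [eval_rmember]
    refine norm_sum_le_of_le _ fun n hn => ?_
    rw [norm_mul, norm_pow, Complex.norm_real, Real.norm_eq_abs]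
    gcongr
    calc ‖z‖ ^ n ≤ (1 + ‖z‖) ^ n := by gcongr; linarith
      _ ≤ (1 + ‖z‖) ^ N :=
        pow_le_pow_right₀ (by linarith) (Nat.lt_succ_iff.1 (Finset.mem_range.1 hn))
  rw [← Finset.sum_mul] at this
  nlinarith [pow_pos (by linarith : 0 < 1 + ‖z‖) N]

/-! ### Monotonicity of the phase along the imaginary axis -/

theorem multiset_sum_re_pos (s : Multiset ℂ) (hs : s ≠ 0) (g : ℂ → ℂ) (h : ∀ r ∈ s, 0 < (g r).re) :
    0 < (s.map g).sum.re := by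
  induction s using Multiset.induction_on with
  | empty => exact absurd rfl hs
  | cons r s ih =>
    rw [Multiset.map_cons, Multiset.sum_cons, Complex.add_re]
    have hr := h r (Multiset.mem_cons_self r s)
    by_cases h0 : s = 0
    · simpa [h0] using hr
    · exact add_pos hr (ih h0 fun x hx => h x (Multiset.mem_cons_of_mem hx))

theorem Hurwitz.phase_derivative_pos {P : ℂ[X]} (hP : Hurwitz P) (hdeg : P.natDegree ≠ 0)
    {z : ℂ} (hz : 0 ≤ z.re) :
    0 < (P.derivative.eval z).re * (P.eval z).re + (P.derivative.eval z).im * (P.eval z).im := by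
  have hne := hP.2 z hz
  have hroots : P.roots ≠ 0 := by
    rwa [← IsAlgClosed.card_roots_eq_natDegree, Ne, Multiset.card_eq_zero] at hdeg
  have hsum := multiset_sum_re_pos P.roots hroots (fun r => 1 / (z - r)) fun r hr => by
    have h1 := hP.re_root_neg hr
    have h2 : 0 < (z - r).re := by rw [Complex.sub_re]; linarith
    have h3 : z - r ≠ 0 := fun h => by simp [h] at h2
    rw [one_div, Complex.inv_re]
    exact div_pos h2 (Complex.normSq_pos.2 h3)
  rw [← (IsAlgClosed.splits P).eval_derivative_div_eval_of_ne_zero hne, Complex.div_re,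
    ← add_div] at hsum
  exact (div_pos_iff_of_pos_right (Complex.normSq_pos.2 hne)).1 hsum

/-! ### Even and odd parts on the imaginary axis -/

theorem re_I_mul_pow (ω : ℝ) (n : ℕ) : ((Complex.I * ω) ^ n).re = (Complex.I ^ n).re * ω ^ n := by
  rw [mul_pow, ← Complex.ofReal_pow, Complex.re_mul_ofReal]

theorem im_I_mul_pow (ω : ℝ) (n : ℕ) : ((Complex.I * ω) ^ n).im = (Complex.I ^ n).im * ω ^ n := by
  rw [mul_pow, ← Complex.ofReal_pow, Complex.im_mul_ofReal]

theorem re_I_pow (n : ℕ) :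
    (Complex.I ^ n).re = if n % 4 = 0 then 1 else if n % 4 = 2 then -1 else 0 := by
  rw [Complex.I_pow_eq_pow_mod]
  have : n % 4 < 4 := Nat.mod_lt _ (by norm_num)
  interval_cases n % 4 <;> simp [pow_succ]

theorem im_I_pow (n : ℕ) :
    (Complex.I ^ n).im = if n % 4 = 1 then 1 else if n % 4 = 3 then -1 else 0 := by
  rw [Complex.I_pow_eq_pow_mod]
  have : n % 4 < 4 := Nat.mod_lt _ (by norm_num)
  interval_cases n % 4 <;> simp [pow_succ]

theorem re_eval_rmember (N : ℕ) (a : ℕ → ℝ) (z : ℂ) :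
    ((rmember N a).eval z).re = ∑ n ∈ Finset.range (N + 1), a n * (z ^ n).re := by
  simp only [eval_rmember, Complex.re_sum, Complex.re_ofReal_mul]

theorem im_eval_rmember (N : ℕ) (a : ℕ → ℝ) (z : ℂ) :
    ((rmember N a).eval z).im = ∑ n ∈ Finset.range (N + 1), a n * (z ^ n).im := by
  simp only [eval_rmember, Complex.im_sum, Complex.im_ofReal_mul]

theorem re_im_eval_congr_of_even (N : ℕ) {a b : ℕ → ℝ} (h : ∀ n, n % 2 = 0 → a n = b n) (ω : ℝ) :
    ((rmember N a).eval (Complex.I * ω)).re = ((rmember N b).eval (Complex.I * ω)).re ∧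
    ((derivative (rmember N a)).eval (Complex.I * ω)).im =
      ((derivative (rmember N b)).eval (Complex.I * ω)).im := by
  constructor
  · rw [re_eval_rmember, re_eval_rmember]
    refine Finset.sum_congr rfl fun n _ => ?_
    rcases Nat.mod_two_eq_zero_or_one n with hn | hn
    · rw [h n hn]
    · rw [re_I_mul_pow, re_I_pow, if_neg (by omega), if_neg (by omega)]
      ring
  · simp only [eval_derivative_rmember, Complex.im_sum, Complex.im_ofReal_mul]
    refine Finset.sum_congr rfl fun n _ => ?_
    rcases Nat.mod_two_eq_zero_or_one n with hn | hn
    · rw [h n hn]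
    · rw [im_I_mul_pow, im_I_pow, if_neg (by omega), if_neg (by omega)]
      ring

theorem im_re_eval_congr_of_odd (N : ℕ) {a b : ℕ → ℝ} (h : ∀ n, n % 2 = 1 → a n = b n) (ω : ℝ) :
    ((rmember N a).eval (Complex.I * ω)).im = ((rmember N b).eval (Complex.I * ω)).im ∧
    ((derivative (rmember N a)).eval (Complex.I * ω)).re =
      ((derivative (rmember N b)).eval (Complex.I * ω)).re := by
  constructor
  · rw [im_eval_rmember, im_eval_rmember]
    refine Finset.sum_congr rfl fun n _ => ?_
    rcases Nat.mod_two_eq_zero_or_one n with hn | hn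
    · rw [im_I_mul_pow, im_I_pow, if_neg (by omega), if_neg (by omega)]
      ring
    · rw [h n hn]
  · simp only [eval_derivative_rmember, Complex.re_sum, Complex.re_ofReal_mul]
    refine Finset.sum_congr rfl fun n _ => ?_
    rcases Nat.mod_two_eq_zero_or_one n with hn | hn
    · rcases Nat.eq_zero_or_pos n with rfl | hpos
      · simp
      rw [re_I_mul_pow, re_I_pow, if_neg (by omega), if_neg (by omega)]
      ring
    · rw [h n hn]

/-- On the upper imaginary axis the values of a member lie in the Kharitonov rectangle. -/
theorem eval_mem_rectangle {N : ℕ} {l u a : ℕ → ℝ} (ha : ∀ n ≤ N, l n ≤ a n ∧ a n ≤ u n)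
    {ω : ℝ} (hω : 0 ≤ ω) :
    (((rmember N (pick l u (pat false false true true))).eval (Complex.I * ω)).re ≤
        ((rmember N a).eval (Complex.I * ω)).re ∧
      ((rmember N a).eval (Complex.I * ω)).re ≤
        ((rmember N (pick l u (pat true true false false))).eval (Complex.I * ω)).re) ∧
    (((rmember N (pick l u (pat false false true true))).eval (Complex.I * ω)).im ≤
        ((rmember N a).eval (Complex.I * ω)).im ∧
      ((rmember N a).eval (Complex.I * ω)).im ≤
        ((rmember N (pick l u (pat true true false false))).eval (Complex.I * ω)).im) := by
  simp only [re_eval_rmember, im_eval_rmember, re_I_mul_pow, im_I_mul_pow, re_I_pow, im_I_pow]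
  refine ⟨⟨?_, ?_⟩, ?_, ?_⟩ <;>
  · refine Finset.sum_le_sum fun n hn => ?_
    obtain ⟨h1, h2⟩ := ha n (Nat.lt_succ_iff.1 (Finset.mem_range.1 hn))
    have hp := pow_nonneg hω n
    obtain h | h | h | h : n % 4 = 0 ∨ n % 4 = 1 ∨ n % 4 = 2 ∨ n % 4 = 3 := by omega
    all_goals simp [pick, pat, h] <;> nlinarith

/-! ### Zero exclusion on the imaginary axis -/

theorem false_of_corners {F₁ F₂ f₁ f₂ G₁ G₂ g₁ g₂ : ℝ}
    (h₁₁ : 0 < g₁ * F₁ + f₁ * G₁) (h₁₂ : 0 < g₂ * F₁ + f₁ * G₂)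
    (h₂₁ : 0 < g₁ * F₂ + f₂ * G₁) (h₂₂ : 0 < g₂ * F₂ + f₂ * G₂)
    (hF₁ : F₁ ≤ 0) (hF₂ : 0 ≤ F₂) (hG₁ : G₁ ≤ 0) (hG₂ : 0 ≤ G₂) : False := by
  obtain ⟨p, q, hp, hq, hpq, h0⟩ : ∃ p q : ℝ, 0 ≤ p ∧ 0 ≤ q ∧ 0 < p + q ∧ p * F₁ + q * F₂ = 0 := by
    rcases hF₁.eq_or_lt with h | h
    · exact ⟨1, 0, by norm_num, le_rfl, by norm_num, by rw [h]; ring⟩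
    · exact ⟨F₂, -F₁, hF₂, by linarith, by linarith, by ring⟩
  have comb {x y : ℝ} (hx : 0 < x) (hy : 0 < y) : 0 < p * x + q * y := by
    rcases hp.eq_or_lt with h | h
    · subst h
      have : 0 < q := by linarith
      positivity
    · positivity
  have e₁ : 0 < (p * f₁ + q * f₂) * G₁ := by linear_combination comb h₁₁ h₂₁ + g₁ * h0
  have e₂ : 0 < (p * f₁ + q * f₂) * G₂ := by linear_combination comb h₁₂ h₂₂ + g₂ * h0
  rcases le_total 0 (p * f₁ + q * f₂) with h | h
  · exact e₁.not_ge (mul_nonpos_of_nonneg_of_nonpos h hG₁)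
  · exact e₂.not_ge (mul_nonpos_of_nonpos_of_nonneg h hG₂)

theorem pick_mem {N : ℕ} {l u : ℕ → ℝ} (hlu : ∀ n ≤ N, l n ≤ u n) (p : ℕ → Bool) :
    ∀ n ≤ N, l n ≤ pick l u p n ∧ pick l u p n ≤ u n := by
  intro n hn
  have := hlu n hn
  unfold pick
  split_ifs <;> simp [this]

theorem eval_imaginary_axis_ne_zero {N : ℕ} (hN : 1 ≤ N) {l u : ℕ → ℝ}
    (hlu : ∀ n ≤ N, l n ≤ u n) (hpos : 0 < l N)
    (h₁ : Hurwitz (rmember N (pick l u (pat false false true true))))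
    (h₂ : Hurwitz (rmember N (pick l u (pat false true true false))))
    (h₃ : Hurwitz (rmember N (pick l u (pat true true false false))))
    (h₄ : Hurwitz (rmember N (pick l u (pat true false false true))))
    {a : ℕ → ℝ} (ha : ∀ n ≤ N, l n ≤ a n ∧ a n ≤ u n) {z : ℂ} (hz : z.re = 0) :
    (rmember N a).eval z ≠ 0 := by
  wlog hω : 0 ≤ z.im generalizing z
  · intro h
    refine this (z := (starRingEnd ℂ) z) (by simpa using hz) (by simp; linarith) ?_
    rw [eval_rmember_conj, h, map_zero]
  intro h0
  obtain ⟨ω, rfl⟩ : ∃ ω : ℝ, z = Complex.I * ω := ⟨z.im, by apply Complex.ext <;> simp [hz]⟩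
  have hω' : 0 ≤ ω := by simpa using hω
  obtain ⟨⟨hF₁, hF₂⟩, hG₁, hG₂⟩ := eval_mem_rectangle ha hω'
  rw [h0, Complex.zero_re] at hF₁ hF₂
  rw [h0, Complex.zero_im] at hG₁ hG₂
  have phase (p : ℕ → Bool) (hp : Hurwitz (rmember N (pick l u p))) :=
    hp.phase_derivative_pos (z := Complex.I * ω)
      (by
        rw [natDegree_rmember (hpos.trans_le (pick_mem hlu p N le_rfl).1).ne']
        omega)
      (by simp)
  have even {p q : ℕ → Bool} (h : ∀ n, n % 2 = 0 → p n = q n) :=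
    re_im_eval_congr_of_even N (a := pick l u p) (b := pick l u q)
      (fun n hn => by simp only [pick, h n hn]) ω
  have odd {p q : ℕ → Bool} (h : ∀ n, n % 2 = 1 → p n = q n) :=
    im_re_eval_congr_of_odd N (a := pick l u p) (b := pick l u q)
      (fun n hn => by simp only [pick, h n hn]) ω
  have pat_even (w x y z x' z' : Bool) (n : ℕ) (hn : n % 2 = 0) :
      pat w x y z n = pat w x' y z' n := by
    obtain h | h : n % 4 = 0 ∨ n % 4 = 2 := by omega
    all_goals simp [pat, h]
  have pat_odd (w x y z w' y' : Bool) (n : ℕ) (hn : n % 2 = 1) :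
      pat w x y z n = pat w' x y' z n := by
    obtain h | h : n % 4 = 1 ∨ n % 4 = 3 := by omega
    all_goals simp [pat, h]
  have p₁ := phase _ h₁
  have p₂ := phase _ h₂
  have p₃ := phase _ h₃
  have p₄ := phase _ h₄
  rw [(even (pat_even false true true false false true)).1,
    (even (pat_even false true true false false true)).2,
    (odd (pat_odd false true true false true false)).1,
    (odd (pat_odd false true true false true false)).2] at p₂
  rw [(even (pat_even true false false true true false)).1,
    (even (pat_even true false false true true false)).2,
    (odd (pat_odd true false false true false true)).1,
    (odd (pat_odd true false false true false true)).2] at p₄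
  exact false_of_corners p₁ p₂ p₄ p₃ hF₁ hF₂ hG₁ hG₂

/-! ### Continuation along a segment -/

theorem eval_rmember_add_smul (N : ℕ) (a b : ℕ → ℝ) (t : ℝ) (z : ℂ) :
    (rmember N (a + t • b)).eval z =
      (rmember N a).eval z + t * (rmember N b).eval z := by
  simp only [eval_rmember, Finset.mul_sum, ← Finset.sum_add_distrib]
  refine Finset.sum_congr rfl fun n _ => ?_
  simp only [Pi.add_apply, Pi.smul_apply, smul_eq_mul]
  push_cast
  ring

theorem hurwitz_of_segment {N : ℕ} {a b : ℕ → ℝ} {c : ℝ} (hc : 0 < c)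
    (hlead : ∀ t ∈ Set.Icc (0 : ℝ) 1, c ≤ (a + t • b) N)
    (haxis : ∀ t ∈ Set.Icc (0 : ℝ) 1, ∀ z : ℂ, z.re = 0 → (rmember N (a + t • b)).eval z ≠ 0)
    (ha : Hurwitz (rmember N a)) : Hurwitz (rmember N (a + b)) := by
  have hne (t : ℝ) (ht : t ∈ Set.Icc (0 : ℝ) 1) : (a + t • b) N ≠ 0 := (hc.trans_le (hlead t ht)).ne'
  -- On the segment, the Hurwitz property is equivalent to a closed condition on `t`.
  let S : Set ℝ := {t | ∀ z : ℂ, 0 ≤ z.re → c * z.re ^ N ≤ ‖(rmember N (a + t • b)).eval z‖}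
  have hS (t : ℝ) (ht : t ∈ Set.Icc (0 : ℝ) 1) : t ∈ S ↔ Hurwitz (rmember N (a + t • b)) := by
    constructor
    · intro h
      refine ⟨rmember_ne_zero (hne t ht), fun z hz => ?_⟩
      rcases hz.eq_or_lt with h0 | h0
      · exact haxis t ht z h0.symm
      · exact norm_pos_iff.1 ((by positivity : 0 < c * z.re ^ N).trans_le (h z hz))
    · intro h z hz
      have := h.leadingCoeff_mul_re_pow_le hz
      rw [leadingCoeff_rmember (hne t ht), natDegree_rmember (hne t ht), Complex.norm_real] at this
      refine le_trans ?_ this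
      gcongr
      exact (hlead t ht).trans (le_abs_self _)
  have hclosed : IsClosed S := by
    simp only [S, Set.ofPred_forall, eval_rmember_add_smul]
    refine isClosed_iInter fun z => isClosed_iInter fun _ => isClosed_le (by fun_prop) (by fun_prop)
  have hzero : (0 : ℝ) ∈ S := (hS 0 (by simp)).2 (by simpa using ha)
  have hsub : Set.Icc (0 : ℝ) 1 ⊆ S := by
    refine (hclosed.inter isClosed_Icc).Icc_subset_of_forall_exists_gt hzero ?_
    rintro t ⟨htS, ht0, ht1⟩ y hy
    rw [Set.mem_Ioi] at hy
    have ht : t ∈ Set.Icc (0 : ℝ) 1 := ⟨ht0, ht1.le⟩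
    obtain ⟨δ, hδ, hlow⟩ := ((hS t ht).1 htS).exists_mul_pow_le
    rw [natDegree_rmember (hne t ht)] at hlow
    obtain ⟨M, hM, hup⟩ := exists_norm_eval_rmember_le N b
    let ε := min (min (y - t) (1 - t)) (δ / (2 * M))
    have hε : 0 < ε := lt_min (lt_min (by linarith) (by linarith)) (by positivity)
    have hεy : ε ≤ y - t := (min_le_left _ _).trans (min_le_left _ _)
    have hε1 : ε ≤ 1 - t := (min_le_left _ _).trans (min_le_right _ _)
    have hεM : ε * M < δ := by
      have := min_le_right (min (y - t) (1 - t)) (δ / (2 * M))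
      have h2 : ε * (2 * M) ≤ δ := (le_div_iff₀ (by positivity)).1 this
      nlinarith [mul_pos hε hM]
    have ht' : t + ε ∈ Set.Icc (0 : ℝ) 1 := ⟨by linarith, by linarith⟩
    refine ⟨t + ε, (hS _ ht').2 ⟨rmember_ne_zero (hne _ ht'), fun z hz h0 => ?_⟩,
      by linarith, by linarith⟩
    have hz' : 0 < (1 + ‖z‖) ^ N := by positivity
    have key : (rmember N (a + t • b)).eval z = -(ε * (rmember N b).eval z) := by
      rw [eval_rmember_add_smul] at h0 ⊢
      push_cast at h0
      linear_combination h0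
    have hl := hlow z hz
    rw [key, norm_neg, norm_mul, Complex.norm_real, Real.norm_of_nonneg hε.le] at hl
    nlinarith [mul_le_mul_of_nonneg_left (hup z) hε.le, mul_lt_mul_of_pos_right hεM hz']
  simpa using (hS 1 (by simp)).1 (hsub (by simp))

/-- Real Kharitonov theorem (K4PT). -/
theorem k4pt (N : ℕ) (hN : 1 ≤ N) (l u : ℕ → ℝ)
    (hlu : ∀ n ≤ N, l n ≤ u n) (hpos : 0 < l N) :
    (∀ a : ℕ → ℝ, (∀ n ≤ N, l n ≤ a n ∧ a n ≤ u n) → Hurwitz (rmember N a)) ↔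
      (Hurwitz (rmember N (pick l u (pat false false true true))) ∧
       Hurwitz (rmember N (pick l u (pat false true true false))) ∧
       Hurwitz (rmember N (pick l u (pat true true false false))) ∧
       Hurwitz (rmember N (pick l u (pat true false false true)))) := by
  constructor
  · intro h
    exact ⟨h _ (pick_mem hlu _), h _ (pick_mem hlu _), h _ (pick_mem hlu _), h _ (pick_mem hlu _)⟩
  · rintro ⟨h₁, h₂, h₃, h₄⟩ a ha
    let k := pick l u (pat false false true true)
    have hk : ∀ n ≤ N, l n ≤ k n ∧ k n ≤ u n := pick_mem hlu _
    have hmem (t : ℝ) (ht : t ∈ Set.Icc (0 : ℝ) 1) (n : ℕ) (hn : n ≤ N) :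
        l n ≤ (k + t • (a - k)) n ∧ (k + t • (a - k)) n ≤ u n := by
      obtain ⟨h0, h1⟩ := ht
      obtain ⟨hk1, hk2⟩ := hk n hn
      obtain ⟨ha1, ha2⟩ := ha n hn
      simp only [Pi.add_apply, Pi.smul_apply, Pi.sub_apply, smul_eq_mul]
      constructor <;> nlinarith
    have := hurwitz_of_segment (N := N) (a := k) (b := a - k) hpos
      (fun t ht => (hmem t ht N le_rfl).1)
      (fun t ht z hz => eval_imaginary_axis_ne_zero hN hlu hpos h₁ h₂ h₃ h₄ (hmem t ht) hz) h₁
    simpa using this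
end

section
/- Correctness of the counterclockwise-rotation test (Case (ii), complex case): Let N ≥ 1, β ∈ (0, π/2), and let la, ua, lb, ub : {0,…,N} → ℝ with la n ≤ ua n and lb n ≤ ub n for all n. Define rotated interval bounds Lc n = lo(cos(nβ), la n, ua n) + lo(sin(nβ), lb n, ub n), Uc n = hi(cos(nβ), la n, ua n) + hi(sin(nβ), lb n, ub n), Ld n = lo(−sin(nβ), la n, ua n) + lo(cos(nβ), lb n, ub n), Ud n = hi(−sin(nβ), la n, ua n) + hi(cos(nβ), lb n, ub n) (these enclose the real and imaginary parts of e^{-inβ}(a_n + i b_n)). Assume: (1) every member polynomial P_{a,b}(s) = Σ_{n=0}^N (a_n + i b_n) s^n with la n ≤ a_n ≤ ua n and lb n ≤ b_n ≤ ub n is Hurwitz, and (2) every polynomial Σ_{n=0}^N (c_n + i d_n) s^n with Lc n ≤ c_n ≤ Uc n and Ld n ≤ d_n ≤ Ud n is Hurwitz. Then for every member P_{a,b} of the original family and every root z ∈ ℂ of P_{a,b}, both Re z < 0 and Re(e^{iβ} z) < 0 hold; equivalently, arg(−z) ∈ (−π/2, π/2 − β), i.e. the sector {s : π/2 < angle(s)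 ≤ 3π/2 − β} contains all roots of all members. -/
open Polynomial

/-- The member polynomial `∑ (a n + i b n) s^n` of an interval family. -/
noncomputable def member (N : ℕ) (a b : ℕ → ℝ) : Polynomial ℂ :=
  ∑ n ∈ Finset.range (N + 1), C ((a n : ℂ) + (b n : ℂ) * Complex.I) * X ^ n

/-- Lower endpoint of the interval `x·[p,q]` of interval arithmetic. -/
noncomputable def lo (x p q : ℝ) : ℝ := if 0 ≤ x then x * p else x * q

/-- Upper endpoint of the interval `x·[p,q]` of interval arithmetic. -/
noncomputable def hi (x p q : ℝ) : ℝ := if 0 ≤ x then x * q else x * p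

lemma lo_le_mul {x p q y : ℝ} (h : p ≤ y ∧ y ≤ q) : lo x p q ≤ x * y := by
  unfold lo
  split_ifs with hx
  · exact mul_le_mul_of_nonneg_left h.1 hx
  · exact mul_le_mul_of_nonpos_left h.2 (not_le.mp hx).le

lemma mul_le_hi {x p q y : ℝ} (h : p ≤ y ∧ y ≤ q) : x * y ≤ hi x p q := by
  unfold hi
  split_ifs with hx
  · exact mul_le_mul_of_nonneg_left h.2 hx
  · exact mul_le_mul_of_nonpos_left h.1 (not_le.mp hx).le

lemma eval_member (N : ℕ) (a b : ℕ → ℝ) (z : ℂ) :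
    (member N a b).eval z =
      ∑ n ∈ Finset.range (N + 1), ((a n : ℂ) + (b n : ℂ) * Complex.I) * z ^ n := by
  simp [member, eval_finsetSum]

/-- Multiplying the `n`-th coefficient by `e^{-inβ}` multiplies the roots by `e^{iβ}`. -/
lemma eval_member_rotate (N : ℕ) (a b : ℕ → ℝ) (β : ℝ) (z : ℂ) :
    (member N (fun n => Real.cos (n * β) * a n + Real.sin (n * β) * b n)
      (fun n => -Real.sin (n * β) * a n + Real.cos (n * β) * b n)).eval
        (Complex.exp ((β : ℂ) * Complex.I) * z) = (member N a b).eval z := by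
  simp only [eval_member]
  refine Finset.sum_congr rfl fun n _ => ?_
  have hexp : Complex.exp ((β : ℂ) * Complex.I) ^ n =
      Complex.cos (n * β) + Complex.sin (n * β) * Complex.I := by
    rw [← Complex.exp_nat_mul, ← mul_assoc, Complex.exp_mul_I]
  rw [mul_pow, hexp]
  push_cast
  have hI : Complex.I ^ 2 = -1 := Complex.I_sq
  linear_combination
    (((a n : ℂ) + b n * Complex.I) * z ^ n) * Complex.cos_sq_add_sin_sq (n * β : ℂ) +
    (Complex.sin (n * β) * (-Complex.sin (n * β) * a n + Complex.cos (n * β) * b n) * z ^ n) * hI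

/-- A point of the open right half-plane whose rotation by `β` stays there has argument in
`(-π/2, π/2 - β)`. -/
lemma arg_mem_Ioo_of_re_pos {w : ℂ} {β : ℝ} (hβ : β < Real.pi / 2) (hw : 0 < w.re)
    (hrot : 0 < (Complex.exp ((β : ℂ) * Complex.I) * w).re) :
    Complex.arg w ∈ Set.Ioo (-(Real.pi / 2)) (Real.pi / 2 - β) := by
  obtain ⟨hlow, hupp⟩ := abs_lt.mp (Complex.abs_arg_lt_pi_div_two_iff.mpr (Or.inl hw))
  refine ⟨hlow, ?_⟩
  by_contra! hge
  have hre : (Complex.exp ((β : ℂ) * Complex.I) * w).re = ‖w‖ * Real.cos (w.arg + β) := by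
    conv_lhs => rw [← Complex.norm_mul_exp_arg_mul_I w]
    rw [mul_left_comm, ← Complex.exp_add, Complex.re_ofReal_mul, ← add_mul, ← Complex.ofReal_add,
      Complex.exp_ofReal_mul_I_re, add_comm]
  have hcos : Real.cos (w.arg + β) ≤ 0 :=
    Real.cos_nonpos_of_pi_div_two_le_of_le (by linarith) (by linarith [Real.pi_pos])
  exact absurd hrot (not_lt.mpr (hre ▸ mul_nonpos_of_nonneg_of_nonpos (norm_nonneg w) hcos))

/-- Correctness of the counterclockwise-rotation test (Case (ii), complex case): if the
original family and the rotated family (with interval coefficients enclosing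
`e^{-inβ}(a_n + i b_n)`) are both robustly Hurwitz, then every root `z` of every member
satisfies `Re z < 0` and `Re (e^{iβ} z) < 0`, i.e. `arg (−z) ∈ (−π/2, π/2 − β)`. -/
theorem rotation_test_ccw (N : ℕ) (hN : 1 ≤ N) (β : ℝ)
    (hβ : 0 < β ∧ β < Real.pi / 2)
    (la ua lb ub : ℕ → ℝ)
    (hA : ∀ n ≤ N, la n ≤ ua n) (hB : ∀ n ≤ N, lb n ≤ ub n)
    (h1 : ∀ a b : ℕ → ℝ, (∀ n ≤ N, la n ≤ a n ∧ a n ≤ ua n) →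
      (∀ n ≤ N, lb n ≤ b n ∧ b n ≤ ub n) → Hurwitz (member N a b))
    (h2 : ∀ c d : ℕ → ℝ,
      (∀ n ≤ N, lo (Real.cos (n * β)) (la n) (ua n) + lo (Real.sin (n * β)) (lb n) (ub n) ≤ c n ∧
        c n ≤ hi (Real.cos (n * β)) (la n) (ua n) + hi (Real.sin (n * β)) (lb n) (ub n)) →
      (∀ n ≤ N, lo (-Real.sin (n * β)) (la n) (ua n) + lo (Real.cos (n * β)) (lb n) (ub n) ≤ d n ∧
        d n ≤ hi (-Real.sin (n * β)) (la n) (ua n) + hi (Real.cos (n * β)) (lb n) (ub n)) →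
      Hurwitz (member N c d)) :
    ∀ a b : ℕ → ℝ, (∀ n ≤ N, la n ≤ a n ∧ a n ≤ ua n) →
      (∀ n ≤ N, lb n ≤ b n ∧ b n ≤ ub n) →
      ∀ z : ℂ, (member N a b).eval z = 0 →
        (z.re < 0 ∧ (Complex.exp ((β : ℂ) * Complex.I) * z).re < 0) ∧
        Complex.arg (-z) ∈ Set.Ioo (-(Real.pi / 2)) (Real.pi / 2 - β) := by
  intro a b ha hb z hz
  have hre : z.re < 0 := by
    by_contra! h
    exact (h1 a b ha hb).2 z h hz
  have hrot : (Complex.exp ((β : ℂ) * Complex.I) * z).re < 0 := by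
    by_contra! h
    refine (h2 _ _ (fun n hn => ⟨?_, ?_⟩) (fun n hn => ⟨?_, ?_⟩)).2 _ h
      ((eval_member_rotate N a b β z).trans hz)
    · exact add_le_add (lo_le_mul (ha n hn)) (lo_le_mul (hb n hn))
    · exact add_le_add (mul_le_hi (ha n hn)) (mul_le_hi (hb n hn))
    · exact add_le_add (lo_le_mul (ha n hn)) (lo_le_mul (hb n hn))
    · exact add_le_add (mul_le_hi (ha n hn)) (mul_le_hi (hb n hn))
  refine ⟨⟨hre, hrot⟩, arg_mem_Ioo_of_re_pos hβ.2 ?_ ?_⟩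
  · simpa using hre
  · rw [mul_neg, Complex.neg_re]
    exact neg_pos.mpr hrot
end
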